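/- Under condition [A], there exists Δ > 0 such that for every α0 with |α0 − a| ≤ Δ the series I(α0) := Σ_{l=1}^∞ e^{λ(α0) l} E(e^{μ(α0) R(l)}; τ ≥ l | Y(0) = y0) converges; more precisely, there exist constants K > 0 and ρ' > 0 such that each term is bounded by K e^{−ρ' l}. -/

import Mathlib

noncomputable section

/-- A chain with unbounded variable length memory over the binary alphabet `{0,1}`,
with memory parameter `v ≥ 1`.  For `k ∈ ℕ ∪ {0}` (the distance from the current
position to the nearest `1`) and a word `w` of `v - 1` letters (the letters standing
to the left of that `1`), `p k w` is the probability of appending the character `1`.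
The structure records the sample space, the appended characters `X n = r_n(n)`,
the full configuration `cfg`, the position `mpos ω n` of the rightmost `1` among the
coordinates `≤ n`, and the Markov transition rule `htrans`. -/
structure VLMC (v : ℕ) (p : ℕ → (Fin (v - 1) → Bool) → ℝ) where
  /-- the sample space -/
  Ω : Type
  [mΩ : MeasurableSpace Ω]
  /-- the underlying probability measure -/
  P : MeasureTheory.Measure Ω
  hprob : MeasureTheory.IsProbabilityMeasure P
  hv : 0 < v
  /-- the (fixed) initial configuration; only the coordinates `i ≤ 0` are relevant -/
  r0 : ℤ → Bool
  /-- `X n` is the random character appended at step `n`, for `n ≥ 1` -/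
  X : ℕ → Ω → Bool
  hXmeas : ∀ n, Measurable (X n)
  /-- the full configuration (it does not change in time: at time `n` only the
  coordinates `≤ n` are relevant) -/
  cfg : Ω → ℤ → Bool
  hcfg : ∀ ω i, cfg ω i = if i ≤ 0 then r0 i else X i.toNat ω
  /-- `mpos ω n` is the position of the rightmost `1` among the coordinates `≤ n` -/
  mpos : Ω → ℕ → ℤ
  hmpos : ∀ ω n, mpos ω n ≤ (n : ℤ) ∧ cfg ω (mpos ω n) = true ∧
    ∀ i : ℤ, mpos ω n < i → i ≤ (n : ℤ) → cfg ω i = false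
  /-- the transition rule: on any cylinder (in the appended characters) on which the
  distance from `n` to the nearest `1` equals `k` and the word of the `v - 1` letters
  standing to the left of that `1` equals `w`, the conditional probability that the
  character appended at step `n + 1` equals `1` is `p k w`. -/
  htrans : ∀ (n : ℕ) (b : Fin n → Bool) (k : ℕ) (w : Fin (v - 1) → Bool),
    (∀ ω, (∀ i : Fin n, X (i.1 + 1) ω = b i) →
      ((n : ℤ) - mpos ω n = (k : ℤ) ∧
        ∀ j : Fin (v - 1), cfg ω (mpos ω n - ((v : ℤ) - 1) + (j.1 : ℤ)) = w j)) →
    P {ω | (∀ i : Fin n, X (i.1 + 1) ω = b i) ∧ X (n + 1) ω = true}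
      = ENNReal.ofReal (p k w) * P {ω | ∀ i : Fin n, X (i.1 + 1) ω = b i}

open MeasureTheory Filter

namespace VLMC

variable {v : ℕ} {p : ℕ → (Fin (v - 1) → Bool) → ℝ}

/-- Condition [A]: the initial configuration contains at least one `1`, and all the
transition probabilities lie between `δ2` and `δ1`, where `0 < δ2 < δ1 < 1`. -/
def CondA (S : VLMC v p) (δ1 δ2 : ℝ) : Prop :=
  (∃ i : ℤ, i ≤ 0 ∧ S.r0 i = true) ∧
  0 < δ2 ∧ δ2 < δ1 ∧ δ1 < 1 ∧
  ∀ (k : ℕ) (w : Fin (v - 1) → Bool), δ2 ≤ p k w ∧ p k w ≤ δ1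

/-- `R n`, the number of `1`s appended during the first `n` steps -/
def R (S : VLMC v p) (n : ℕ) (ω : S.Ω) : ℕ :=
  ∑ k ∈ Finset.Icc 1 n, (S.X k ω).toNat

/-- `Y(n) = y₀ = (0,(0,…,0,1))`, i.e. the character at position `n` is `1` and the
`v - 1` letters to its left are all `0` -/
def hitY0 (S : VLMC v p) (ω : S.Ω) (n : ℕ) : Prop :=
  S.mpos ω n = (n : ℤ) ∧
    ∀ j : Fin (v - 1), S.cfg ω ((n : ℤ) - ((v : ℤ) - 1) + (j.1 : ℤ)) = false

/-- `T k`, the time of the `k`-th visit of the chain `Y` to the state `y₀`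
(`T 0 = 0`) -/
def T (S : VLMC v p) : ℕ → S.Ω → ℕ
  | 0, _ => 0
  | k + 1, ω => sInf {n | T S k ω < n ∧ S.hitY0 ω n}

/-- `τ_k = T_k - T_{k-1}`, the spacings between consecutive visits to `y₀` -/
def tau (S : VLMC v p) (k : ℕ) (ω : S.Ω) : ℕ := S.T k ω - S.T (k - 1) ω

/-- `ζ_k`, the number of `1`s appended at the times `n ∈ (T_{k-1}, T_k]` -/
def zeta (S : VLMC v p) (k : ℕ) (ω : S.Ω) : ℕ :=
  ∑ n ∈ Finset.Ioc (S.T (k - 1) ω) (S.T k ω), (S.X n ω).toNat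

/-- `ν(n) = max {k ≥ 0 : T_k < n}` -/
def nu (S : VLMC v p) (n : ℕ) (ω : S.Ω) : ℕ := sSup {k | S.T k ω < n}

/-- the generalized renewal process `Z(n) = Σ_{k=0}^{ν(n)} ζ_k` (with `ζ_0 = 0`) -/
def Z (S : VLMC v p) (n : ℕ) (ω : S.Ω) : ℕ :=
  ∑ k ∈ Finset.range (S.nu n ω + 1), S.zeta k ω

/-- `a = E ζ / E τ`, where `(τ, ζ) = (τ_2, ζ_2)` has the common distribution of the
regeneration vectors `ξ_k = (τ_k, ζ_k)`, `k ≥ 2` -/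
def a (S : VLMC v p) : ℝ :=
  (∫ ω, (S.zeta 2 ω : ℝ) ∂S.P) / (∫ ω, (S.tau 2 ω : ℝ) ∂S.P)

/-- `σ² = E (ζ - aτ)² / E τ` -/
def sigma2 (S : VLMC v p) : ℝ :=
  (∫ ω, ((S.zeta 2 ω : ℝ) - S.a * (S.tau 2 ω : ℝ)) ^ 2 ∂S.P) /
    (∫ ω, (S.tau 2 ω : ℝ) ∂S.P)

/-- `ψ(λ,μ) = E e^{λτ + μζ}` (as an extended nonnegative real number) -/
def psi (S : VLMC v p) (l m : ℝ) : ENNReal :=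
  ∫⁻ ω, ENNReal.ofReal (Real.exp (l * S.tau 2 ω + m * S.zeta 2 ω)) ∂S.P

/-- `ψ₁(λ,μ) = E e^{λτ₁ + μζ₁}` -/
def psi1 (S : VLMC v p) (l m : ℝ) : ℝ :=
  ∫ ω, Real.exp (l * S.tau 1 ω + m * S.zeta 1 ω) ∂S.P

/-- the deviation function `D(θ,α) = sup {λθ + μα : A(λ,μ) ≤ 0}` where `A = ln ψ`,
so that `A(λ,μ) ≤ 0 ↔ ψ(λ,μ) ≤ 1` -/
def D2 (S : VLMC v p) (θ α : ℝ) : ℝ :=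
  sSup {x | ∃ l m : ℝ, S.psi l m ≤ 1 ∧ x = l * θ + m * α}

/-- `D(α) = D(1,α)` -/
def D (S : VLMC v p) (α : ℝ) : ℝ := S.D2 1 α

/-- the chain starts from the state `y₀ = (0,(0,…,0,1))`, i.e. `Y(0) = y₀`: the
initial configuration has a `1` at position `0` preceded by `v - 1` zeros -/
def StartsAtY0 (S : VLMC v p) : Prop :=
  S.r0 0 = true ∧ ∀ i : ℤ, 1 - (v : ℤ) ≤ i → i < 0 → S.r0 i = false

end VLMC



namespace VLMC

attribute [local instance] VLMC.mΩ VLMC.hprob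

/-! ### Events determined by finitely many appended characters -/

section Cylinders

variable {v : ℕ} {p : ℕ → (Fin (v - 1) → Bool) → ℝ}

/-- The first `n` appended characters. -/
def firstChars (S : VLMC v p) (n : ℕ) (ω : S.Ω) : Fin n → Bool := fun i => S.X (i.1 + 1) ω

/-- The event `E` is determined by the first `n` appended characters. -/
def DeterminedBy (S : VLMC v p) (n : ℕ) (E : Set S.Ω) : Prop :=
  ∀ ω ω' : S.Ω, (∀ i < n, S.X (i + 1) ω = S.X (i + 1) ω') → ω ∈ E → ω' ∈ E

/-- The characters number `n + 1, …, n + L` spell the first `L` letters of `w`. -/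
def blockEvent (S : VLMC v p) (n L : ℕ) (w : ℕ → Bool) : Set S.Ω :=
  {ω | ∀ i < L, S.X (n + i + 1) ω = w i}

lemma measurable_firstChars (S : VLMC v p) (n : ℕ) : Measurable (S.firstChars n) :=
  measurable_pi_iff.2 fun i => S.hXmeas (i.1 + 1)

lemma DeterminedBy.preimage_image {S : VLMC v p} {n : ℕ} {E : Set S.Ω}
    (hE : S.DeterminedBy n E) : S.firstChars n ⁻¹' (S.firstChars n '' E) = E := by
  refine Set.Subset.antisymm ?_ (Set.subset_preimage_image _ _)
  rintro ω ⟨ω', hω', h⟩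
  exact hE ω' ω (fun i hi => congrFun h ⟨i, hi⟩) hω'

lemma DeterminedBy.measurableSet {S : VLMC v p} {n : ℕ} {E : Set S.Ω}
    (hE : S.DeterminedBy n E) : MeasurableSet E := by
  rw [← hE.preimage_image]
  exact S.measurable_firstChars n (Set.toFinite _).measurableSet

lemma measurableSet_X_eq (S : VLMC v p) (n : ℕ) (c : Bool) : MeasurableSet {ω | S.X n ω = c} :=
  S.hXmeas n (measurableSet_singleton c)

lemma cfg_natCast (S : VLMC v p) (ω : S.Ω) {n : ℕ} (hn : 0 < n) : S.cfg ω n = S.X n ω := by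
  rw [S.hcfg, if_neg (by omega)]
  simp

lemma cfg_congr (S : VLMC v p) {n : ℕ} {ω ω' : S.Ω}
    (h : ∀ i < n, S.X (i + 1) ω = S.X (i + 1) ω') {i : ℤ} (hi : i ≤ n) :
    S.cfg ω i = S.cfg ω' i := by
  rw [S.hcfg, S.hcfg]
  split_ifs with h0
  · rfl
  · have := h (i.toNat - 1) (by omega)
    rwa [show i.toNat - 1 + 1 = i.toNat by omega] at this

lemma mpos_congr (S : VLMC v p) {n : ℕ} {ω ω' : S.Ω}
    (h : ∀ i < n, S.X (i + 1) ω = S.X (i + 1) ω') : S.mpos ω n = S.mpos ω' n := by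
  obtain ⟨h1, h2, h3⟩ := S.hmpos ω n
  obtain ⟨h1', h2', h3'⟩ := S.hmpos ω' n
  rcases lt_trichotomy (S.mpos ω n) (S.mpos ω' n) with hlt | heq | hlt
  · have := h3 _ hlt h1'
    rw [S.cfg_congr h h1', h2'] at this
    cases this
  · exact heq
  · have := h3' _ hlt h1
    rw [← S.cfg_congr h h1, h2] at this
    cases this

lemma mpos_eq_iff (S : VLMC v p) (ω : S.Ω) (n : ℕ) : S.mpos ω n = n ↔ S.cfg ω n = true := by
  obtain ⟨h1, h2, h3⟩ := S.hmpos ω n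
  refine ⟨fun h => h ▸ h2, fun h => ?_⟩
  by_contra hne
  have := h3 n (lt_of_le_of_ne h1 hne) le_rfl
  rw [h] at this
  cases this

lemma determinedBy_hitY0 (S : VLMC v p) (n : ℕ) : S.DeterminedBy n {ω | S.hitY0 ω n} := by
  rintro ω ω' h ⟨h1, h2⟩
  refine ⟨S.mpos_congr h ▸ h1, fun j => ?_⟩
  rw [← S.cfg_congr h (by have := j.2; omega)]
  exact h2 j

/-- Appending any prescribed character to a cylinder costs at most a factor `q`. -/
lemma mul_measure_cylinder_le (S : VLMC v p) {q : ℝ} (hq0 : 0 ≤ q)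
    (hq : ∀ k w, q ≤ p k w ∧ q ≤ 1 - p k w) (n : ℕ) (b : Fin n → Bool) (c : Bool) :
    ENNReal.ofReal q * S.P (S.firstChars n ⁻¹' {b}) ≤
      S.P (S.firstChars n ⁻¹' {b} ∩ {ω | S.X (n + 1) ω = c}) := by
  rcases (S.firstChars n ⁻¹' {b}).eq_empty_or_nonempty with hem | ⟨ω₀, hω₀⟩
  · simp [hem]
  have hcyl : S.firstChars n ⁻¹' {b} = {ω | ∀ i : Fin n, S.X (i.1 + 1) ω = b i} := by
    ext ω
    simp [firstChars, funext_iff]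
  obtain ⟨k, hk⟩ : ∃ k : ℕ, (n : ℤ) - S.mpos ω₀ n = k :=
    ⟨((n : ℤ) - S.mpos ω₀ n).toNat, by have := (S.hmpos ω₀ n).1; omega⟩
  have htrue := S.htrans n b k
    (fun j => S.cfg ω₀ (S.mpos ω₀ n - ((v : ℤ) - 1) + (j.1 : ℤ))) (by
      intro ω hω
      have hag : ∀ i < n, S.X (i + 1) ω = S.X (i + 1) ω₀ := fun i hi =>
        (hω ⟨i, hi⟩).trans (congrFun hω₀ ⟨i, hi⟩).symm
      rw [S.mpos_congr hag]
      refine ⟨hk, fun j => S.cfg_congr hag ?_⟩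
      have := (S.hmpos ω₀ n).1
      have := j.2
      omega)
  generalize (fun j : Fin (v - 1) => S.cfg ω₀ (S.mpos ω₀ n - ((v : ℤ) - 1) + (j.1 : ℤ))) = w
    at htrue
  rw [Set.ofPred_and, ← hcyl] at htrue
  obtain ⟨hq1, hq2⟩ := hq k w
  cases c with
  | true =>
    rw [htrue]
    gcongr
  | false =>
    have hsplit := measure_inter_add_sdiff (μ := S.P) (S.firstChars n ⁻¹' {b})
      (S.measurableSet_X_eq (n + 1) true)
    have hdiff : S.firstChars n ⁻¹' {b} \ {ω | S.X (n + 1) ω = true} =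
        S.firstChars n ⁻¹' {b} ∩ {ω | S.X (n + 1) ω = false} := by
      ext ω
      simp
    rw [hdiff] at hsplit
    apply ENNReal.le_of_add_le_add_left
      (measure_ne_top S.P (S.firstChars n ⁻¹' {b} ∩ {ω | S.X (n + 1) ω = true}))
    rw [hsplit, htrue, ← add_mul, ← ENNReal.ofReal_add (hq0.trans hq1) hq0]
    refine mul_le_of_le_one_left' ?_
    rw [ENNReal.ofReal_le_one]
    linarith

lemma DeterminedBy.mul_measureReal_le {S : VLMC v p} {q : ℝ} (hq0 : 0 ≤ q)
    (hq : ∀ k w, q ≤ p k w ∧ q ≤ 1 - p k w) {n : ℕ} {E : Set S.Ω} (hE : S.DeterminedBy n E)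
    (c : Bool) : q * S.P.real E ≤ S.P.real (E ∩ {ω | S.X (n + 1) ω = c}) := by
  classical
  have key : ENNReal.ofReal q * S.P E ≤ S.P (E ∩ {ω | S.X (n + 1) ω = c}) := by
    have hfin : (S.firstChars n '' E).Finite := Set.toFinite _
    have hm : ∀ b ∈ hfin.toFinset, MeasurableSet (S.firstChars n ⁻¹' {b}) := fun b _ =>
      S.measurable_firstChars n (measurableSet_singleton b)
    have h1 := sum_measure_preimage_singleton (μ := S.P) hfin.toFinset hm
    have h2 := sum_measure_preimage_singleton
      (μ := S.P.restrict {ω | S.X (n + 1) ω = c}) hfin.toFinset hm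
    rw [hfin.coe_toFinset, hE.preimage_image] at h1 h2
    rw [Measure.restrict_apply hE.measurableSet] at h2
    rw [← h1, ← h2, Finset.mul_sum]
    refine Finset.sum_le_sum fun b hb => ?_
    rw [Measure.restrict_apply (hm b hb)]
    exact S.mul_measure_cylinder_le hq0 hq n b c
  have := ENNReal.toReal_mono (measure_ne_top _ _) key
  rwa [ENNReal.toReal_mul, ENNReal.toReal_ofReal hq0] at this

lemma DeterminedBy.inter_block {S : VLMC v p} {n : ℕ} {E : Set S.Ω} (hE : S.DeterminedBy n E)
    (L : ℕ) (w : ℕ → Bool) : S.DeterminedBy (n + L) (E ∩ S.blockEvent n L w) := by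
  rintro ω ω' h ⟨h1, h2⟩
  refine ⟨hE ω ω' (fun i hi => h i (by omega)) h1, fun i hi => ?_⟩
  rw [← h (n + i) (by omega)]
  exact h2 i hi

lemma DeterminedBy.pow_mul_measureReal_le {S : VLMC v p} {q : ℝ} (hq0 : 0 ≤ q)
    (hq : ∀ k w, q ≤ p k w ∧ q ≤ 1 - p k w) {n : ℕ} {E : Set S.Ω} (hE : S.DeterminedBy n E)
    (L : ℕ) (w : ℕ → Bool) : q ^ L * S.P.real E ≤ S.P.real (E ∩ S.blockEvent n L w) := by
  induction L with
  | zero => simp [blockEvent]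
  | succ L ih =>
    have hset : E ∩ S.blockEvent n (L + 1) w =
        (E ∩ S.blockEvent n L w) ∩ {ω | S.X (n + L + 1) ω = w L} := by
      rw [Set.inter_assoc]
      congr 1
      ext ω
      exact Nat.forall_lt_succ_right
    rw [hset]
    calc q ^ (L + 1) * S.P.real E = q * (q ^ L * S.P.real E) := by ring
      _ ≤ q * S.P.real (E ∩ S.blockEvent n L w) := by gcongr
      _ ≤ _ := (hE.inter_block L w).mul_measureReal_le hq0 hq (w L)

/-- None of the first `n` consecutive blocks of length `L` spells `w`. -/
def noBlock (S : VLMC v p) (n L : ℕ) (w : ℕ → Bool) : Set S.Ω :=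
  {ω | ∀ j < n, ω ∉ S.blockEvent (j * L) L w}

lemma determinedBy_noBlock (S : VLMC v p) (n L : ℕ) (w : ℕ → Bool) :
    S.DeterminedBy (n * L) (S.noBlock n L w) := by
  intro ω ω' h h1 j hj h2
  refine h1 j hj fun i hi => ?_
  rw [h (j * L + i)]
  · exact h2 i hi
  · calc j * L + i < (j + 1) * L := by rw [add_mul, one_mul]; omega
      _ ≤ n * L := Nat.mul_le_mul_right L hj

lemma measureReal_noBlock_le (S : VLMC v p) {q : ℝ} (hq0 : 0 ≤ q) (hq1 : q ≤ 1)
    (hq : ∀ k w, q ≤ p k w ∧ q ≤ 1 - p k w) (n L : ℕ) (w : ℕ → Bool) :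
    S.P.real (S.noBlock n L w) ≤ (1 - q ^ L) ^ n := by
  induction n with
  | zero => simp [noBlock]
  | succ n ih =>
    have hD := S.determinedBy_noBlock n L w
    have hstep := hD.pow_mul_measureReal_le hq0 hq L w
    have hsplit := measureReal_sdiff_add_inter (μ := S.P) (s := S.noBlock n L w)
      (hD.inter_block L w).measurableSet
    have hdiff : S.noBlock (n + 1) L w =
        S.noBlock n L w \ (S.noBlock n L w ∩ S.blockEvent (n * L) L w) := by
      ext ω
      rw [Set.sdiff_self_inter]
      exact Nat.forall_lt_succ_right
    rw [Set.inter_eq_right.2 Set.inter_subset_left, ← hdiff] at hsplit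
    have : 0 ≤ 1 - q ^ L := sub_nonneg.2 (pow_le_one₀ hq0 hq1)
    calc S.P.real (S.noBlock (n + 1) L w)
        ≤ (1 - q ^ L) * S.P.real (S.noBlock n L w) := by linarith
      _ ≤ (1 - q ^ L) * (1 - q ^ L) ^ n := by gcongr
      _ = _ := by ring

end Cylinders

/-! ### Visits to `y₀` -/

section Visits

variable {v : ℕ} {p : ℕ → (Fin (v - 1) → Bool) → ℝ}

/-- The word with ones exactly at the (one-based) positions `v` and `v + d`. -/
def returnWord (v d : ℕ) (i : ℕ) : Bool := decide (i + 1 = v ∨ i + 1 = v + d)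

lemma X_eq_true_of_hitY0 {S : VLMC v p} {ω : S.Ω} {n : ℕ} (hn : 0 < n) (h : S.hitY0 ω n) :
    S.X n ω = true := by
  rw [← S.cfg_natCast ω hn]
  exact (S.mpos_eq_iff ω n).1 h.1

lemma hitY0_of_run (S : VLMC v p) {ω : S.Ω} {n : ℕ} (hn : v ≤ n) (h1 : S.X n ω = true)
    (h0 : ∀ i, n < i + v → i < n → S.X i ω = false) : S.hitY0 ω n := by
  have hv := S.hv
  refine ⟨(S.mpos_eq_iff ω n).2 (by rwa [S.cfg_natCast ω (by omega)]), fun j => ?_⟩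
  have hj := j.2
  have hcast : (n : ℤ) - ((v : ℤ) - 1) + (j.1 : ℤ) = ((n + 1 + j.1 - v : ℕ) : ℤ) := by omega
  rw [hcast, S.cfg_natCast ω (by omega)]
  exact h0 _ (by omega) (by omega)

lemma X_of_mem_blockEvent {S : VLMC v p} {ω : S.Ω} {m d i : ℕ}
    (hω : ω ∈ S.blockEvent m (v + d) (returnWord v d)) (h1 : m < i) (h2 : i ≤ m + v + d) :
    S.X i ω = decide (i = m + v ∨ i = m + v + d) := by
  have h := hω (i - m - 1) (by omega)
  rw [show m + (i - m - 1) + 1 = i by omega] at h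
  rw [h, returnWord]
  congr 1
  apply propext
  omega

lemma hitY0_left_of_mem_blockEvent {S : VLMC v p} {ω : S.Ω} {m d : ℕ} (hd : v ≤ d)
    (hω : ω ∈ S.blockEvent m (v + d) (returnWord v d)) : S.hitY0 ω (m + v) := by
  have hv := S.hv
  refine S.hitY0_of_run (by omega) ?_ fun i h1 h2 => ?_
  · rw [X_of_mem_blockEvent hω (by omega) (by omega)]
    simp
  · rw [X_of_mem_blockEvent hω (by omega) (by omega), decide_eq_false_iff_not]
    omega

lemma hitY0_right_of_mem_blockEvent {S : VLMC v p} {ω : S.Ω} {m d : ℕ} (hd : v ≤ d)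
    (hω : ω ∈ S.blockEvent m (v + d) (returnWord v d)) : S.hitY0 ω (m + v + d) := by
  have hv := S.hv
  refine S.hitY0_of_run (by omega) ?_ fun i h1 h2 => ?_
  · rw [X_of_mem_blockEvent hω (by omega) (by omega)]
    simp
  · rw [X_of_mem_blockEvent hω (by omega) (by omega), decide_eq_false_iff_not]
    omega

lemma T_succ_le {S : VLMC v p} {ω : S.Ω} {k n : ℕ} (h1 : S.T k ω < n) (h2 : S.hitY0 ω n) :
    S.T (k + 1) ω ≤ n :=
  Nat.sInf_le ⟨h1, h2⟩

lemma T_succ_eq {S : VLMC v p} {ω : S.Ω} {k n : ℕ} (h1 : S.T k ω < n) (h2 : S.hitY0 ω n)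
    (h3 : ∀ m, S.T k ω < m → m < n → ¬ S.hitY0 ω m) : S.T (k + 1) ω = n := by
  refine le_antisymm (T_succ_le h1 h2) (le_csInf ⟨n, h1, h2⟩ ?_)
  rintro m ⟨hm1, hm2⟩
  by_contra hlt
  exact h3 m hm1 (by omega) hm2

lemma T_one_lt_and_T_two_le_of_mem_blockEvent {S : VLMC v p} {ω : S.Ω} {m d : ℕ} (hd : v ≤ d)
    (hω : ω ∈ S.blockEvent m (v + d) (returnWord v d)) :
    S.T 1 ω < m + v + d ∧ S.T 2 ω ≤ m + v + d := by
  have hv := S.hv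
  have h1 : S.T 1 ω ≤ m + v :=
    T_succ_le (k := 0) (by change 0 < _; omega) (hitY0_left_of_mem_blockEvent hd hω)
  have h2 : S.T 1 ω < m + v + d := by omega
  exact ⟨h2, T_succ_le h2 (hitY0_right_of_mem_blockEvent hd hω)⟩

lemma tau_zeta_two_of_mem_blockEvent {S : VLMC v p} {ω : S.Ω} {d : ℕ} (hd : v ≤ d)
    (hω : ω ∈ S.blockEvent 0 (v + d) (returnWord v d)) :
    S.tau 2 ω = d ∧ S.zeta 2 ω = 1 := by
  have hv := S.hv
  have hX : ∀ i, 0 < i → i ≤ v + d → S.X i ω = decide (i = v ∨ i = v + d) := by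
    intro i h1 h2
    simpa using X_of_mem_blockEvent hω (i := i) (by omega) (by omega)
  have hno : ∀ i, 0 < i → i ≤ v + d → S.hitY0 ω i → i = v ∨ i = v + d := by
    intro i h1 h2 h
    have := X_eq_true_of_hitY0 h1 h
    rwa [hX i h1 h2, decide_eq_true_iff] at this
  have h1 : S.T 1 ω = v := by
    refine T_succ_eq (k := 0) hv (by simpa using hitY0_left_of_mem_blockEvent hd hω) ?_
    intro m hm1 hm2 hm
    have := hno m hm1 (by omega) hm
    omega
  have h2 : S.T 2 ω = v + d := by
    refine T_succ_eq (k := 1) (by omega) (by simpa using hitY0_right_of_mem_blockEvent hd hω) ?_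
    intro m hm1 hm2 hm
    have := hno m (by omega) (by omega) hm
    omega
  refine ⟨by simp [tau, h1, h2], ?_⟩
  simp only [zeta, h2, h1, Nat.add_one_sub_one]
  rw [Finset.sum_eq_single_of_mem (v + d) (by simp; omega)]
  · rw [hX _ (by omega) le_rfl]
    simp
  · intro i hi hne
    rw [Finset.mem_Ioc] at hi
    rw [hX i (by omega) hi.2]
    have : ¬ (i = v ∨ i = v + d) := by omega
    simp [this]

lemma mem_noBlock_of_lt_T {S : VLMC v p} {ω : S.Ω} {n d k : ℕ} (hd : v ≤ d)
    (hk : k = 1 ∨ k = 2) (h : n * (v + d) < S.T k ω) :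
    ω ∈ S.noBlock n (v + d) (returnWord v d) := by
  intro j hj hω
  have h' := T_one_lt_and_T_two_le_of_mem_blockEvent hd hω
  have : (j + 1) * (v + d) ≤ n * (v + d) := Nat.mul_le_mul_right _ hj
  rw [add_mul, one_mul] at this
  rcases hk with rfl | rfl <;> omega

/-- The first two visit times to `y₀` have exponentially decaying tails. -/
lemma exists_tail_bound (S : VLMC v p) {q : ℝ} (hq0 : 0 < q) (hq1 : q ≤ 1)
    (hq : ∀ k w, q ≤ p k w ∧ q ≤ 1 - p k w) :
    ∃ K > (0 : ℝ), ∃ ρ > (0 : ℝ), ∀ k, k = 1 ∨ k = 2 → ∀ l : ℕ, 1 ≤ l →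
      S.P.real {ω | l ≤ S.T k ω} ≤ K * Real.exp (-ρ * l) := by
  have hv := S.hv
  set L := v + v with hL
  have hLpos : (0 : ℝ) < L := by exact_mod_cast (by omega : 0 < L)
  set c := q ^ L with hc
  have hc0 : 0 < c := by positivity
  refine ⟨Real.exp c, Real.exp_pos _, c / L, by positivity, fun k hk l hl => ?_⟩
  set n := (l - 1) / L with hn
  have hnl : n * L ≤ l - 1 := Nat.div_mul_le_self _ _
  have hln : l ≤ (n + 1) * L := by
    have := Nat.lt_div_mul_add (a := l - 1) (b := L) (by omega)
    rw [add_mul, one_mul, hn]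
    omega
  have hsub : {ω | l ≤ S.T k ω} ⊆ S.noBlock n L (returnWord v v) := fun ω hω =>
    mem_noBlock_of_lt_T le_rfl hk (by
      have : l ≤ S.T k ω := hω
      rw [← hL]
      omega)
  calc S.P.real {ω | l ≤ S.T k ω} ≤ S.P.real (S.noBlock n L (returnWord v v)) :=
        measureReal_mono hsub
    _ ≤ (1 - c) ^ n := S.measureReal_noBlock_le hq0.le hq1 hq n L _
    _ ≤ Real.exp (-c) ^ n := by
        have h1 : c ≤ 1 := pow_le_one₀ hq0.le hq1
        have h2 := Real.add_one_le_exp (-c)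
        exact pow_le_pow_left₀ (by linarith) (by linarith) n
    _ = Real.exp (n * (-c)) := (Real.exp_nat_mul _ _).symm
    _ ≤ Real.exp (c + -(c / L) * l) := by
        apply Real.exp_le_exp.2
        have hln' : (l : ℝ) ≤ (n + 1) * L := by exact_mod_cast hln
        have : c / L * l ≤ c * (n + 1) := by
          rw [div_mul_eq_mul_div, div_le_iff₀ hLpos]
          nlinarith
        linarith
    _ = _ := Real.exp_add _ _

lemma measurable_T (S : VLMC v p) (k : ℕ) : Measurable (S.T k) := by
  induction k with
  | zero => exact measurable_const
  | succ k ih =>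
    have hset : ∀ n, MeasurableSet {ω | S.T k ω < n ∧ S.hitY0 ω n} := fun n =>
      (measurableSet_lt ih measurable_const).inter (S.determinedBy_hitY0 n).measurableSet
    refine measurable_of_Ioi fun m => ?_
    have : S.T (k + 1) ⁻¹' Set.Ioi m =
        (⋃ n, {ω | S.T k ω < n ∧ S.hitY0 ω n}) ∩
          ⋂ n, ⋂ _ : n ≤ m, {ω | S.T k ω < n ∧ S.hitY0 ω n}ᶜ := by
      ext ω
      simp only [Set.mem_preimage, Set.mem_Ioi, Set.mem_inter_iff, Set.mem_iUnion,
        Set.mem_iInter, Set.mem_compl_iff]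
      constructor
      · intro h
        refine ⟨Nat.nonempty_of_pos_sInf (s := {n | S.T k ω < n ∧ S.hitY0 ω n})
          (lt_of_le_of_lt (Nat.zero_le m) h), fun n hn hmem => ?_⟩
        exact absurd (T_succ_le hmem.1 hmem.2) (by omega)
      · rintro ⟨hne, h⟩
        by_contra hle
        exact h (S.T (k + 1) ω) (by omega)
          (Nat.sInf_mem (s := {n | S.T k ω < n ∧ S.hitY0 ω n}) hne)
    rw [this]
    exact (MeasurableSet.iUnion hset).inter
      (MeasurableSet.iInter fun n => MeasurableSet.iInter fun _ => (hset n).compl)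

lemma measurable_tau (S : VLMC v p) (k : ℕ) : Measurable (S.tau k) :=
  (S.measurable_T k).sub (S.measurable_T (k - 1))

lemma measurable_zeta (S : VLMC v p) (k : ℕ) : Measurable (S.zeta k) := by
  have hf : Measurable fun x : S.Ω × (ℕ × ℕ) =>
      ∑ n ∈ Finset.Ioc x.2.1 x.2.2, (S.X n x.1).toNat :=
    measurable_from_prod_countable_left fun y =>
      Finset.measurable_fun_sum (Finset.Ioc y.1 y.2) (f := fun n ω => (S.X n ω).toNat)
        fun n _ => (measurable_of_finite Bool.toNat).comp (S.hXmeas n)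
  exact hf.comp (measurable_id.prodMk ((S.measurable_T (k - 1)).prodMk (S.measurable_T k)))

lemma zeta_le_tau (S : VLMC v p) (k : ℕ) (ω : S.Ω) : S.zeta k ω ≤ S.tau k ω := by
  refine (Finset.sum_le_card_nsmul _ _ 1 fun n _ => Bool.toNat_le _).trans ?_
  simp [tau]

lemma R_le (S : VLMC v p) (n : ℕ) (ω : S.Ω) : S.R n ω ≤ n := by
  refine (Finset.sum_le_card_nsmul _ _ 1 fun n _ => Bool.toNat_le _).trans ?_
  simp

end Visits

/-! ### Exponential moments of a non-degenerate pair -/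

section ExponentialMoments

variable {Ω : Type*} [MeasurableSpace Ω] {P : Measure Ω}

lemma integrable_exp_and_integral_le_one {Y : Ω → ℝ} (hm : AEStronglyMeasurable Y P)
    (h : ∫⁻ ω, ENNReal.ofReal (Real.exp (Y ω)) ∂P ≤ 1) :
    Integrable (fun ω => Real.exp (Y ω)) P ∧ ∫ ω, Real.exp (Y ω) ∂P ≤ 1 := by
  have hmexp : AEStronglyMeasurable (fun ω => Real.exp (Y ω)) P :=
    Real.continuous_exp.comp_aestronglyMeasurable hm
  have hpos : 0 ≤ᵐ[P] fun ω => Real.exp (Y ω) := Eventually.of_forall fun _ => (Real.exp_pos _).le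
  constructor
  · rw [← lintegral_ofReal_ne_top_iff_integrable hmexp hpos]
    exact ne_top_of_le_ne_top ENNReal.one_ne_top h
  · rw [integral_eq_lintegral_of_nonneg_ae hpos hmexp]
    exact ENNReal.toReal_le_of_le_ofReal zero_le_one (by simpa using h)

variable [IsProbabilityMeasure P]

lemma integral_nonpos_of_lintegral_exp_le_one {Y : Ω → ℝ} (hY : Integrable Y P)
    (h : ∫⁻ ω, ENNReal.ofReal (Real.exp (Y ω)) ∂P ≤ 1) : ∫ ω, Y ω ∂P ≤ 0 := by
  obtain ⟨hi, hle⟩ := integrable_exp_and_integral_le_one hY.aestronglyMeasurable h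
  have : ∫ ω, Y ω ∂P ≤ ∫ ω, (Real.exp (Y ω) - 1) ∂P :=
    integral_mono hY (hi.sub (integrable_const 1)) fun ω => by
      have := Real.add_one_le_exp (Y ω)
      change Y ω ≤ Real.exp (Y ω) - 1
      linarith
  rw [integral_sub hi (integrable_const 1)] at this
  simp only [integral_const, probReal_univ, smul_eq_mul, mul_one] at this
  linarith

lemma one_lt_lintegral_exp {Y : Ω → ℝ} (hY : Integrable Y P) (h0 : ∫ ω, Y ω ∂P = 0)
    (hne : ¬ Y =ᵐ[P] 0) : 1 < ∫⁻ ω, ENNReal.ofReal (Real.exp (Y ω)) ∂P := by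
  by_contra! h
  obtain ⟨hi, hle⟩ := integrable_exp_and_integral_le_one hY.aestronglyMeasurable h
  have hnn : ∀ ω, 0 ≤ Real.exp (Y ω) - 1 - Y ω := fun ω => by
    have := Real.add_one_le_exp (Y ω)
    linarith
  have hi1 : Integrable (fun ω => Real.exp (Y ω) - 1) P := hi.sub (integrable_const 1)
  have hint : Integrable (fun ω => Real.exp (Y ω) - 1 - Y ω) P := hi1.sub hY
  have hval : ∫ ω, (Real.exp (Y ω) - 1 - Y ω) ∂P ≤ 0 := by
    rw [integral_sub hi1 hY, integral_sub hi (integrable_const 1), h0]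
    simp only [integral_const, probReal_univ, smul_eq_mul, mul_one]
    linarith
  have hzero := (integral_eq_zero_iff_of_nonneg hnn hint).1
    (le_antisymm hval (integral_nonneg hnn))
  refine hne (hzero.mono fun ω hω => ?_)
  by_contra hYω
  have h1 : Real.exp (Y ω) - 1 - Y ω = 0 := hω
  have h2 := Real.add_one_lt_exp hYω
  linarith

lemma exists_one_lt_lintegral_exp {τ Y : Ω → ℝ} (hτ : Measurable τ) (hτ0 : ∀ ω, 0 ≤ τ ω)
    (hYm : Measurable Y) (hY : Integrable Y P) (h0 : ∫ ω, Y ω ∂P = 0) (hne : ¬ Y =ᵐ[P] 0) :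
    ∀ᶠ n : ℕ in atTop,
      1 < ∫⁻ ω, ENNReal.ofReal (Real.exp (-(1 / ((n : ℝ) + 1)) * τ ω + Y ω)) ∂P := by
  refine (lintegral_tendsto_of_tendsto_of_monotone (F := fun ω => ENNReal.ofReal (Real.exp (Y ω)))
    (fun n => ?_) (Eventually.of_forall fun ω => ?_)
    (Eventually.of_forall fun ω => ?_)).eventually_const_lt (one_lt_lintegral_exp hY h0 hne)
  · exact (((hτ.const_mul _).add hYm).exp.ennreal_ofReal).aemeasurable
  · intro m n hmn
    apply ENNReal.ofReal_le_ofReal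
    apply Real.exp_le_exp.2
    have := Nat.one_div_le_one_div (α := ℝ) hmn
    have := mul_le_mul_of_nonneg_right this (hτ0 ω)
    linarith
  · refine (ENNReal.continuous_ofReal.tendsto _).comp ((Real.continuous_exp.tendsto _).comp ?_)
    simpa using ((tendsto_one_div_add_atTop_nhds_zero_nat (𝕜 := ℝ)).neg.mul_const (τ ω)).add_const
      (Y ω)

lemma lintegral_exp_mul_le_one {Y : Ω → ℝ} (hm : Measurable Y)
    (h : ∫⁻ ω, ENNReal.ofReal (Real.exp (Y ω)) ∂P ≤ 1) {t : ℝ} (ht0 : 0 ≤ t) (ht1 : t ≤ 1) :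
    ∫⁻ ω, ENNReal.ofReal (Real.exp (t * Y ω)) ∂P ≤ 1 := by
  have hpt : ∀ ω, ENNReal.ofReal (Real.exp (t * Y ω)) ≤
      ENNReal.ofReal (1 - t) + ENNReal.ofReal t * ENNReal.ofReal (Real.exp (Y ω)) := by
    intro ω
    rw [← ENNReal.ofReal_mul ht0, ← ENNReal.ofReal_add (by linarith) (by positivity)]
    apply ENNReal.ofReal_le_ofReal
    have := convexOn_exp.2 (Set.mem_univ 0) (Set.mem_univ (Y ω)) (sub_nonneg.2 ht1) ht0 (by ring)
    simpa using this
  calc ∫⁻ ω, ENNReal.ofReal (Real.exp (t * Y ω)) ∂P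
      ≤ ∫⁻ ω, (ENNReal.ofReal (1 - t) + ENNReal.ofReal t * ENNReal.ofReal (Real.exp (Y ω))) ∂P :=
        lintegral_mono hpt
    _ = ENNReal.ofReal (1 - t) +
          ENNReal.ofReal t * ∫⁻ ω, ENNReal.ofReal (Real.exp (Y ω)) ∂P := by
        rw [lintegral_add_left measurable_const, lintegral_const_mul _ hm.exp.ennreal_ofReal]
        simp
    _ ≤ ENNReal.ofReal (1 - t) + ENNReal.ofReal t * 1 := by gcongr
    _ = 1 := by
        rw [mul_one, ← ENNReal.ofReal_add (by linarith) ht0]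
        simp

/-- Near the mean direction, the points of the sublevel set `{ψ ≤ 1}` on the nonnegative side
of the supporting line are close to the origin. -/
lemma exists_abs_le_of_lintegral_exp_le_one {τ ζ : Ω → ℝ} (hτm : Measurable τ)
    (hζm : Measurable ζ) (hτ0 : ∀ ω, 0 ≤ τ ω) (hτ : Integrable τ P) (hζ : Integrable ζ P) {a : ℝ}
    (ha : ∫ ω, (ζ ω - a * τ ω) ∂P = 0) (hne : ¬ (fun ω => ζ ω - a * τ ω) =ᵐ[P] 0)
    {ε : ℝ} (hε : 0 < ε) :
    ∃ Δ > (0 : ℝ), ∀ l m α : ℝ, |α - a| ≤ Δ → 0 ≤ l + α * m →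
      ∫⁻ ω, ENNReal.ofReal (Real.exp (l * τ ω + m * ζ ω)) ∂P ≤ 1 → |m| ≤ ε := by
  have hW : Integrable (fun ω => ζ ω - a * τ ω) P := hζ.sub (hτ.const_mul a)
  have hWm : Measurable fun ω => ζ ω - a * τ ω := hζm.sub (hτm.const_mul a)
  have key : ∀ σ : ℝ, σ ≠ 0 → ∀ᶠ n : ℕ in atTop, 1 < ∫⁻ ω, ENNReal.ofReal
      (Real.exp (-(1 / ((n : ℝ) + 1)) * τ ω + σ * (ζ ω - a * τ ω))) ∂P := by
    intro σ hσ
    refine exists_one_lt_lintegral_exp hτm hτ0 (hWm.const_mul σ) (hW.const_mul σ)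
      (by rw [integral_const_mul, ha, mul_zero]) fun h => hne (h.mono fun ω hω => ?_)
    exact (mul_eq_zero.1 hω).resolve_left hσ
  obtain ⟨n, hn1, hn2⟩ := ((key ε hε.ne').and (key (-ε) (neg_ne_zero.2 hε.ne'))).exists
  have hnpos : (0 : ℝ) < 1 / ((n : ℝ) + 1) := by positivity
  refine ⟨1 / ((n : ℝ) + 1) / ε, by positivity, fun l m α hα hlm hψ => ?_⟩
  generalize 1 / ((n : ℝ) + 1) = η at *
  by_contra! hmε
  have hmpos : 0 < |m| := hε.trans hmε
  set t := ε / |m| with ht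
  have ht0 : 0 < t := by positivity
  have ht1 : t ≤ 1 := (div_le_one hmpos).2 hmε.le
  have htm : t * |m| = ε := div_mul_cancel₀ _ hmpos.ne'
  have hs : -η ≤ t * (l + a * m) := by
    have h1 : (α - a) * m ≤ η / ε * |m| :=
      (le_abs_self _).trans (by rw [abs_mul]; gcongr)
    have h2 : -(η / ε * |m|) ≤ l + a * m := by linarith
    have h3 := mul_le_mul_of_nonneg_left h2 ht0.le
    have h4 : t * -(η / ε * |m|) = -η := by
      rw [show t * -(η / ε * |m|) = -(η / ε * (t * |m|)) by ring, htm, div_mul_cancel₀ _ hε.ne']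
    linarith
  have hle := lintegral_exp_mul_le_one ((hτm.const_mul l).add (hζm.const_mul m)) hψ ht0.le ht1
  have hcmp : ∫⁻ ω, ENNReal.ofReal
      (Real.exp (-η * τ ω + (t * m) * (ζ ω - a * τ ω))) ∂P ≤ 1 := by
    refine (lintegral_mono fun ω => ?_).trans hle
    apply ENNReal.ofReal_le_ofReal
    apply Real.exp_le_exp.2
    have := mul_le_mul_of_nonneg_right hs (hτ0 ω)
    simp only [Pi.add_apply]
    linarith
  rcases abs_cases m with ⟨h, _⟩ | ⟨h, _⟩
  · rw [h] at htm
    rw [htm] at hcmp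
    exact hcmp.not_gt hn1
  · rw [h] at htm
    rw [show t * m = -ε by linarith] at hcmp
    exact hcmp.not_gt hn2

end ExponentialMoments

lemma summable_mul_exp_neg (K : ℝ) {ρ : ℝ} (hρ : 0 < ρ) :
    Summable fun l : ℕ => K * Real.exp (-ρ * ((l + 1 : ℕ) : ℝ)) := by
  refine Summable.mul_left K ?_
  have := (summable_nat_add_iff 1).2 (Real.summable_exp_nat_mul_iff.2 (neg_lt_zero.2 hρ))
  simpa only [mul_comm] using this

lemma integrable_natCast_of_tail {Ω : Type*} [MeasurableSpace Ω] {P : Measure Ω}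
    [IsFiniteMeasure P] {N : Ω → ℕ} (hN : Measurable N) {K ρ : ℝ} (hρ : 0 < ρ)
    (h : ∀ l : ℕ, 1 ≤ l → P.real {ω | l ≤ N ω} ≤ K * Real.exp (-ρ * l)) :
    Integrable (fun ω => (N ω : ℝ)) P := by
  have hset : ∀ l : ℕ, MeasurableSet {ω | l + 1 ≤ N ω} := fun l =>
    measurableSet_le measurable_const hN
  have hsum : ∀ ω, ENNReal.ofReal (N ω : ℝ) =
      ∑' l : ℕ, {ω | l + 1 ≤ N ω}.indicator (fun _ => (1 : ENNReal)) ω := by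
    intro ω
    rw [tsum_eq_sum (s := Finset.range (N ω)), Finset.sum_congr rfl (g := fun _ => 1)]
    · simp
    · intro l hl
      have hlt := Finset.mem_range.1 hl
      simp [hlt]
    · intro l hl
      have hlt := fun h => hl (Finset.mem_range.2 h)
      simpa [Set.indicator_apply, Nat.succ_le_iff] using hlt
  have hmeas : Measurable fun ω => (N ω : ℝ) := (measurable_of_countable _).comp hN
  rw [← lintegral_ofReal_ne_top_iff_integrable hmeas.aestronglyMeasurable
    (Eventually.of_forall fun _ => Nat.cast_nonneg _)]
  simp_rw [hsum]
  rw [lintegral_tsum fun l => (measurable_const.indicator (hset l)).aemeasurable]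
  refine ne_top_of_le_ne_top (summable_mul_exp_neg K hρ).tsum_ofReal_ne_top (ENNReal.tsum_le_tsum fun l => ?_)
  rw [lintegral_indicator_const (hset l), one_mul, ← ofReal_measureReal]
  exact ENNReal.ofReal_le_ofReal (h (l + 1) (by omega))

section Regeneration

variable {v : ℕ} {p : ℕ → (Fin (v - 1) → Bool) → ℝ}

lemma zero_le_D (S : VLMC v p) (α : ℝ) : 0 ≤ S.D α := by
  by_cases hb : BddAbove {x | ∃ l m : ℝ, S.psi l m ≤ 1 ∧ x = l * 1 + m * α}
  · exact le_csSup hb ⟨0, 0, by simp [psi], by simp⟩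
  · exact (Real.sSup_of_not_bddAbove hb).ge

lemma measureReal_blockEvent_pos (S : VLMC v p) {q : ℝ} (hq0 : 0 < q)
    (hq : ∀ k w, q ≤ p k w ∧ q ≤ 1 - p k w) (L : ℕ) (w : ℕ → Bool) :
    0 < S.P.real (S.blockEvent 0 L w) := by
  have hD : S.DeterminedBy 0 Set.univ := fun _ _ _ _ => Set.mem_univ _
  have := hD.pow_mul_measureReal_le hq0.le hq L w
  rw [Set.univ_inter, probReal_univ, mul_one] at this
  exact (pow_pos hq0 L).trans_le this

lemma exists_mem_blockEvent_of_ae (S : VLMC v p) {q : ℝ} (hq0 : 0 < q)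
    (hq : ∀ k w, q ≤ p k w ∧ q ≤ 1 - p k w) (L : ℕ) (w : ℕ → Bool) {A : S.Ω → Prop}
    (hA : ∀ᵐ ω ∂S.P, A ω) : ∃ ω ∈ S.blockEvent 0 L w, A ω := by
  by_contra! h
  have h0 : S.P (S.blockEvent 0 L w) = 0 := measure_mono_null (fun ω hω => h ω hω) hA
  exact (S.measureReal_blockEvent_pos hq0 hq L w).ne' (by simp [measureReal_def, h0])

lemma not_ae_zeta_sub_mul_tau_eq_zero (S : VLMC v p) {q : ℝ} (hq0 : 0 < q)
    (hq : ∀ k w, q ≤ p k w ∧ q ≤ 1 - p k w) (b : ℝ) :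
    ¬ (fun ω => (S.zeta 2 ω : ℝ) - b * S.tau 2 ω) =ᵐ[S.P] 0 := by
  intro h
  have hval : ∀ d, v ≤ d → 1 - b * d = 0 := by
    intro d hd
    obtain ⟨ω, hω, hz⟩ := S.exists_mem_blockEvent_of_ae hq0 hq (v + d) (returnWord v d) h
    obtain ⟨h1, h2⟩ := tau_zeta_two_of_mem_blockEvent hd hω
    simpa [h1, h2] using hz
  have h1 := hval v le_rfl
  have h2 := hval (v + 1) (by omega)
  push_cast at h2
  have hb : b = 0 := by linarith
  simp [hb] at h1

lemma integral_tau_pos (S : VLMC v p) {q : ℝ} (hq0 : 0 < q)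
    (hq : ∀ k w, q ≤ p k w ∧ q ≤ 1 - p k w)
    (hint : Integrable (fun ω => (S.tau 2 ω : ℝ)) S.P) : 0 < ∫ ω, (S.tau 2 ω : ℝ) ∂S.P := by
  have hnn : ∀ ω, (0 : ℝ) ≤ S.tau 2 ω := fun ω => Nat.cast_nonneg _
  refine lt_of_le_of_ne (integral_nonneg hnn) fun h => ?_
  have h0 := (integral_eq_zero_iff_of_nonneg hnn hint).1 h.symm
  obtain ⟨ω, hω, hz⟩ := S.exists_mem_blockEvent_of_ae hq0 hq (v + v) (returnWord v v) h0
  have hv := S.hv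
  have h1 := (tau_zeta_two_of_mem_blockEvent le_rfl hω).1
  have h2 : (S.tau 2 ω : ℝ) = 0 := hz
  rw [Nat.cast_eq_zero] at h2
  omega

lemma exp_mul_setIntegral_le (S : VLMC v p) {K ρ lam mu ε : ℝ} {l : ℕ}
    (hK : S.P.real {ω | l ≤ S.T 1 ω} ≤ K * Real.exp (-ρ * l)) (hε : lam + |mu| ≤ ρ - ε) :
    Real.exp (lam * l) * (∫ ω in {ω | l ≤ S.T 1 ω}, Real.exp (mu * S.R l ω) ∂S.P)
      ≤ K * Real.exp (-ε * l) := by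
  have hbound : ∀ ω ∈ {ω | l ≤ S.T 1 ω}, ‖Real.exp (mu * S.R l ω)‖ ≤ Real.exp (|mu| * l) := by
    intro ω _
    rw [Real.norm_eq_abs, Real.abs_exp]
    apply Real.exp_le_exp.2
    have : (S.R l ω : ℝ) ≤ l := by exact_mod_cast S.R_le l ω
    calc mu * S.R l ω ≤ |mu| * S.R l ω := by gcongr; exact le_abs_self _
      _ ≤ |mu| * l := by gcongr
  have hK0 : 0 ≤ K := by
    by_contra! hneg
    have := mul_neg_of_neg_of_pos hneg (Real.exp_pos (-ρ * l))
    have : 0 ≤ S.P.real {ω | l ≤ S.T 1 ω} := measureReal_nonneg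
    linarith
  calc Real.exp (lam * l) * (∫ ω in {ω | l ≤ S.T 1 ω}, Real.exp (mu * S.R l ω) ∂S.P)
      ≤ Real.exp (lam * l) * (Real.exp (|mu| * l) * S.P.real {ω | l ≤ S.T 1 ω}) := by
        gcongr
        exact (Real.le_norm_self _).trans
          (norm_setIntegral_le_of_norm_le_const (measure_lt_top _ _) hbound)
    _ ≤ Real.exp (lam * l) * (Real.exp (|mu| * l) * (K * Real.exp (-ρ * l))) := by gcongr
    _ = K * Real.exp ((lam + |mu| - ρ) * l) := by
        rw [show (lam + |mu| - ρ) * l = lam * l + |mu| * l + -ρ * l by ring, Real.exp_add,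
          Real.exp_add]
        ring
    _ ≤ K * Real.exp (-ε * l) := by
        gcongr
        linarith

end Regeneration

/-- convergence of the series `I(α₀)`, from the proof of Theorem
1.5(3): for the chain started from `y₀` (so that expectations are the conditional
expectations given `Y(0) = y₀`, and `τ = T₁` is the first return time to `y₀`),
there is `Δ > 0` such that for `|α₀ - a| ≤ Δ` the series
`I(α₀) = Σ_{l ≥ 1} e^{λ(α₀) l} E(e^{μ(α₀) R(l)}; τ ≥ l ∣ Y(0) = y₀)` converges, each
term being bounded by `K e^{-ρ' l}` for some constants `K > 0`, `ρ' > 0`. -/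
theorem statement15 {v : ℕ} {p : ℕ → (Fin (v - 1) → Bool) → ℝ} (S : VLMC v p)
    (hA : ∃ δ1 δ2 : ℝ, S.CondA δ1 δ2) (hstart : S.StartsAtY0) :
    ∃ Δ > (0 : ℝ), ∀ lam mu : ℝ → ℝ,
      (∀ α : ℝ, |α - S.a| ≤ Δ →
        S.psi (lam α) (mu α) = 1 ∧ S.D α = lam α + α * mu α) →
      ∀ α0 : ℝ, |α0 - S.a| ≤ Δ →
        ∃ K > (0 : ℝ), ∃ ρ' > (0 : ℝ),
          (∀ l : ℕ, 1 ≤ l →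
            Real.exp (lam α0 * l) *
                (∫ ω in {ω | l ≤ S.T 1 ω}, Real.exp (mu α0 * S.R l ω) ∂S.P)
              ≤ K * Real.exp (-ρ' * l)) ∧
          Summable (fun l : ℕ => Real.exp (lam α0 * (l + 1)) *
            ∫ ω in {ω | l + 1 ≤ S.T 1 ω},
              Real.exp (mu α0 * S.R (l + 1) ω) ∂S.P) := by
  obtain ⟨δ1, δ2, -, hδ2, hδ, hδ1, hp⟩ := hA
  obtain ⟨q, hq0, hq1, hq⟩ : ∃ q : ℝ, 0 < q ∧ q ≤ 1 ∧ ∀ k w, q ≤ p k w ∧ q ≤ 1 - p k w := by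
    refine ⟨min δ2 (1 - δ1), lt_min hδ2 (by linarith), (min_le_left _ _).trans (by linarith),
      fun k w => ⟨(min_le_left _ _).trans (hp k w).1, (min_le_right _ _).trans ?_⟩⟩
    linarith [(hp k w).2]
  obtain ⟨K, hK, ρ, hρ, htail⟩ := S.exists_tail_bound hq0 hq1 hq
  have hτm : Measurable fun ω => (S.tau 2 ω : ℝ) :=
    (measurable_of_countable _).comp (S.measurable_tau 2)
  have hζm : Measurable fun ω => (S.zeta 2 ω : ℝ) :=
    (measurable_of_countable _).comp (S.measurable_zeta 2)
  have hτ : Integrable (fun ω => (S.tau 2 ω : ℝ)) S.P :=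
    integrable_natCast_of_tail (S.measurable_tau 2) hρ fun l hl =>
      (measureReal_mono fun ω (hω : l ≤ S.tau 2 ω) => hω.trans (Nat.sub_le _ _)).trans
        (htail 2 (Or.inr rfl) l hl)
  have hζ : Integrable (fun ω => (S.zeta 2 ω : ℝ)) S.P :=
    hτ.mono' hζm.aestronglyMeasurable (Eventually.of_forall fun ω => by
      simpa using S.zeta_le_tau 2 ω)
  have hmean := S.integral_tau_pos hq0 hq hτ
  have hcentre : ∫ ω, ((S.zeta 2 ω : ℝ) - S.a * S.tau 2 ω) ∂S.P = 0 := by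
    rw [integral_sub hζ (hτ.const_mul _), integral_const_mul, a, div_mul_cancel₀ _ hmean.ne',
      sub_self]
  have hε : 0 < ρ / 2 / (|S.a| + 1) := by positivity
  obtain ⟨Δ, hΔ, hsmall⟩ := exists_abs_le_of_lintegral_exp_le_one hτm hζm
    (fun ω => Nat.cast_nonneg _) hτ hζ hcentre (S.not_ae_zeta_sub_mul_tau_eq_zero hq0 hq _) hε
  refine ⟨Δ, hΔ, fun lam mu hopt α0 hα0 => ?_⟩
  obtain ⟨hψ, hD⟩ := hopt α0 hα0
  have hmu := hsmall (lam α0) (mu α0) α0 hα0 (hD ▸ S.zero_le_D α0) hψ.le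
  have hline : lam α0 + S.a * mu α0 ≤ 0 := by
    have h := integral_nonpos_of_lintegral_exp_le_one
      ((hτ.const_mul (lam α0)).add (hζ.const_mul (mu α0))) hψ.le
    have hEζ : ∫ ω, (S.zeta 2 ω : ℝ) ∂S.P = S.a * ∫ ω, (S.tau 2 ω : ℝ) ∂S.P := by
      rw [a, div_mul_cancel₀ _ hmean.ne']
    simp only [Pi.add_apply] at h
    rw [integral_add (hτ.const_mul _) (hζ.const_mul _), integral_const_mul, integral_const_mul,
      hEζ] at h
    refine nonpos_of_mul_nonpos_left ?_ hmean
    linarith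
  have hrate : lam α0 + |mu α0| ≤ ρ - ρ / 2 := by
    have h1 : -(S.a * mu α0) ≤ |S.a| * |mu α0| := by
      rw [← abs_mul]
      exact neg_le_abs _
    have h2 : (|S.a| + 1) * |mu α0| ≤ ρ / 2 := by
      rwa [le_div_iff₀' (by positivity)] at hmu
    linarith
  have hterm : ∀ l : ℕ, 1 ≤ l → Real.exp (lam α0 * l) *
      (∫ ω in {ω | l ≤ S.T 1 ω}, Real.exp (mu α0 * S.R l ω) ∂S.P) ≤
        K * Real.exp (-(ρ / 2) * l) := fun l hl =>
    S.exp_mul_setIntegral_le (htail 1 (Or.inl rfl) l hl) hrate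
  refine ⟨K, hK, ρ / 2, half_pos hρ, hterm, ?_⟩
  refine Summable.of_nonneg_of_le (fun l => ?_) (fun l => ?_) (summable_mul_exp_neg K (half_pos hρ))
  · exact mul_nonneg (Real.exp_pos _).le (integral_nonneg fun ω => (Real.exp_pos _).le)
  · simpa using hterm (l + 1) (by omega)

end VLMC
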